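/- Let p be a prime, L a finitely generated free ℤ_p-module, and W a finite subgroup of the group of ℤ_p-linear automorphisms of L whose order is not divisible by p. If the invariant ring F_p[L ⊗ F_p]^W is a polynomial algebra over F_p, then the invariant ring ℤ_p[L]^W is a polynomial algebra over ℤ_p. -/

import Mathlib

open scoped MatrixGroups

/-- The algebra endomorphism of `R[x₁,…,xₙ]` given by the linear substitution of variables
associated to a matrix `g` (i.e. `xᵢ ↦ ∑ⱼ g ⱼ ᵢ • xⱼ`). -/
noncomputable def linearSubstAlgHom {n : ℕ} {R : Type*} [CommRing R]
    (g : Matrix (Fin n) (Fin n) R) :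
    MvPolynomial (Fin n) R →ₐ[R] MvPolynomial (Fin n) R :=
  MvPolynomial.aeval fun i => ∑ j, MvPolynomial.C (g j i) * MvPolynomial.X j

/-- The `R`-subalgebra of polynomials invariant under the linear substitution action of every
matrix in the set `S`. -/
noncomputable def matrixInvariants {n : ℕ} {R : Type*} [CommRing R]
    (S : Set (Matrix (Fin n) (Fin n) R)) : Subalgebra R (MvPolynomial (Fin n) R) :=
  ⨅ g ∈ S, AlgHom.equalizer (linearSubstAlgHom g) (AlgHom.id R (MvPolynomial (Fin n) R))

/-- An `R`-algebra is a polynomial algebra if it is isomorphic, as an `R`-algebra, to a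
polynomial ring over `R` in finitely many variables. -/
def IsPolynomialAlgebra (R : Type*) [CommRing R] (A : Type*) [CommRing A] [Algebra R A] :
    Prop :=
  ∃ m : ℕ, Nonempty (A ≃ₐ[R] MvPolynomial (Fin m) R)

open MvPolynomial

section aux

theorem aux_ringHom_inj {A : Type*} [CommRing A] [IsNoetherianRing A] (φ : A →+* A)
    (h : Function.Surjective φ) : Function.Injective φ := by
  let ker : ℕ →o Ideal A :=
    ⟨fun k => RingHom.ker (φ ^ k), monotone_nat_of_le_succ (fun k x hx => by
      rw [RingHom.mem_ker] at hx ⊢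
      rw [pow_succ', RingHom.mul_def, RingHom.comp_apply, hx, map_zero])⟩
  obtain ⟨N, hN⟩ := monotone_stabilizes_iff_noetherian.2 ‹IsNoetherianRing A› ker
  rw [injective_iff_map_eq_zero]
  intro x hx
  have hs : Function.Surjective (φ ^ N) := by
    rw [RingHom.coe_pow]; exact h.iterate N
  obtain ⟨y, rfl⟩ := hs x
  have h1 : y ∈ ker (N + 1) := by
    change y ∈ RingHom.ker (φ ^ (N + 1))
    rw [RingHom.mem_ker, pow_succ', RingHom.mul_def, RingHom.comp_apply, hx]
  rw [← hN (N + 1) (Nat.le_succ _)] at h1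
  exact h1

variable {n : ℕ} {R : Type*} [CommRing R]

theorem aux_hc_mul_mem (M : Submodule R (MvPolynomial (Fin n) R)) (u w : MvPolynomial (Fin n) R)
    (d : ℕ) (h : ∀ i j, i + j = d → homogeneousComponent i u * homogeneousComponent j w ∈ M) :
    homogeneousComponent d (u * w) ∈ M := by
  have huw : u * w = (∑ i ∈ Finset.range (u.totalDegree + 1), homogeneousComponent i u) *
      ∑ j ∈ Finset.range (w.totalDegree + 1), homogeneousComponent j w := by
    rw [sum_homogeneousComponent u, sum_homogeneousComponent w]
  rw [huw, Finset.sum_mul_sum, map_sum]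
  refine Submodule.sum_mem _ fun i _ => ?_
  rw [map_sum]
  refine Submodule.sum_mem _ fun j _ => ?_
  rw [homogeneousComponent_of_mem (n := i + j) (m := d)
    (((homogeneousComponent_isHomogeneous i u).mul (homogeneousComponent_isHomogeneous j w)))]
  split_ifs with hd
  · exact h i j hd.symm
  · exact zero_mem _

theorem aux_mem_of_hc (M : Submodule R (MvPolynomial (Fin n) R)) (u : MvPolynomial (Fin n) R)
    (h : ∀ d, homogeneousComponent d u ∈ M) : u ∈ M := by
  rw [← sum_homogeneousComponent u]
  exact Submodule.sum_mem _ fun i _ => h i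

theorem aux_hc_of_hom {f : MvPolynomial (Fin n) R} {e : ℕ} (hf : f.IsHomogeneous e) (d : ℕ) :
    homogeneousComponent d f = if d = e then f else 0 :=
  homogeneousComponent_of_mem hf

theorem aux_adjoin_closed {ι : Type*} (f : ι → MvPolynomial (Fin n) R)
    (deg : ι → ℕ) (hf : ∀ i, (f i).IsHomogeneous (deg i)) (a : MvPolynomial (Fin n) R)
    (ha : a ∈ Algebra.adjoin R (Set.range f)) (d : ℕ) :
    homogeneousComponent d a ∈ Algebra.adjoin R (Set.range f) := by
  induction ha using Algebra.adjoin_induction generalizing d with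
  | mem x hx =>
    obtain ⟨i, rfl⟩ := hx
    rw [aux_hc_of_hom (hf i)]
    split_ifs
    · exact Algebra.subset_adjoin ⟨i, rfl⟩
    · exact zero_mem _
  | algebraMap r =>
    rw [algebraMap_eq, aux_hc_of_hom (isHomogeneous_C _ r)]
    split_ifs
    · exact Subalgebra.algebraMap_mem _ r
    · exact zero_mem _
  | add x y _ _ hx hy => rw [map_add]; exact add_mem (hx d) (hy d)
  | mul x y _ _ hx hy =>
    exact aux_hc_mul_mem (Subalgebra.toSubmodule (Algebra.adjoin R (Set.range f))) x y d
      (fun i j _ => Subalgebra.mul_mem _ (hx i) (hy j))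

end aux

section field

variable {n m : ℕ} {k : Type*} [Field k]

/-- elements of `B` with vanishing constant term -/
noncomputable def auxV (B : Subalgebra k (MvPolynomial (Fin n) k)) :
    Submodule k (MvPolynomial (Fin n) k) :=
  Subalgebra.toSubmodule B ⊓ LinearMap.ker (homogeneousComponent (R := k) (σ := Fin n) 0)

theorem auxV_mem (B : Subalgebra k (MvPolynomial (Fin n) k)) (x : MvPolynomial (Fin n) k) :
    x ∈ auxV B ↔ x ∈ B ∧ homogeneousComponent 0 x = 0 := by
  simp [auxV, Submodule.mem_inf]

theorem auxV_hc (B : Subalgebra k (MvPolynomial (Fin n) k))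
    (hB : ∀ b ∈ B, ∀ d, homogeneousComponent d b ∈ B) (x : MvPolynomial (Fin n) k)
    (hx : x ∈ auxV B) (d : ℕ) : homogeneousComponent d x ∈ auxV B := by
  rw [auxV_mem] at hx ⊢
  refine ⟨hB _ hx.1 d, ?_⟩
  rw [aux_hc_of_hom (homogeneousComponent_isHomogeneous d x)]
  split_ifs with h
  · subst h; exact hx.2
  · rfl

theorem aux_graded_nakayama (B : Subalgebra k (MvPolynomial (Fin n) k))
    (hB : ∀ b ∈ B, ∀ d, homogeneousComponent d b ∈ B)
    {ι : Type*} (f : ι → MvPolynomial (Fin n) k)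
    (deg : ι → ℕ) (hf : ∀ i, (f i).IsHomogeneous (deg i))
    (hV : auxV B ≤ Submodule.span k (Set.range f) ⊔ auxV B * auxV B) :
    B ≤ Algebra.adjoin k (Set.range f) := by
  have key : ∀ d, ∀ b ∈ B, homogeneousComponent d b ∈ Algebra.adjoin k (Set.range f) := by
    intro d
    induction d using Nat.strong_induction_on with
    | _ d ih =>
    intro b hb
    rcases Nat.eq_zero_or_pos d with rfl | hd
    · rw [homogeneousComponent_zero]; exact Subalgebra.algebraMap_mem _ _
    · have h1 : homogeneousComponent d b ∈ auxV B := by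
        rw [auxV_mem]
        refine ⟨hB _ hb d, ?_⟩
        rw [aux_hc_of_hom (homogeneousComponent_isHomogeneous d b), if_neg hd.ne]
      obtain ⟨s, hs, v, hv, hsv⟩ := Submodule.mem_sup.1 (hV h1)
      have h2 : homogeneousComponent d (homogeneousComponent d b) = homogeneousComponent d b := by
        rw [aux_hc_of_hom (homogeneousComponent_isHomogeneous d b), if_pos rfl]
      rw [← h2, ← hsv, map_add]
      refine add_mem ?_ ?_
      · apply aux_adjoin_closed f deg hf
        exact Algebra.span_le_adjoin _ _ hs
      · clear hsv
        induction hv using Submodule.mul_induction_on' with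
        | mem_mul_mem u hu w hw =>
          rw [auxV_mem] at hu hw
          refine aux_hc_mul_mem (Subalgebra.toSubmodule (Algebra.adjoin k (Set.range f))) u w d ?_
          intro i j hij
          rcases Nat.eq_zero_or_pos i with rfl | hi
          · rw [hu.2, zero_mul]; exact zero_mem _
          rcases Nat.eq_zero_or_pos j with rfl | hj
          · rw [hw.2, mul_zero]; exact zero_mem _
          exact Subalgebra.mul_mem _ (ih i (by omega) u hu.1) (ih j (by omega) w hw.1)
        | add x _ y _ hx hy =>
          rw [map_add]; exact add_mem hx hy
  intro b hb
  exact aux_mem_of_hc (Subalgebra.toSubmodule (Algebra.adjoin k (Set.range f))) b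
    (fun d => key d b hb)

theorem aux_V_le (B : Subalgebra k (MvPolynomial (Fin n) k)) (y : Fin m → MvPolynomial (Fin n) k)
    (hy : ∀ i, y i ∈ auxV B) (hBy : B ≤ Algebra.adjoin k (Set.range y)) :
    auxV B ≤ Submodule.span k (Set.range y) ⊔ auxV B * auxV B := by
  have hle : Submodule.span k (Set.range y) ≤ auxV B := by
    rw [Submodule.span_le]; rintro _ ⟨i, rfl⟩; exact hy i
  have hVV : auxV B * auxV B ≤ auxV B := by
    rw [Submodule.mul_le]
    intro u hu w hw
    rw [auxV_mem] at *
    refine ⟨mul_mem hu.1 hw.1, ?_⟩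
    have := aux_hc_mul_mem (⊥ : Submodule k (MvPolynomial (Fin n) k)) u w 0 (by
      intro i j hij
      obtain ⟨rfl, rfl⟩ : i = 0 ∧ j = 0 := by omega
      simp [hu.2])
    simpa using this
  have key : ∀ b ∈ Algebra.adjoin k (Set.range y), ∃ c : k, ∃ v ∈
      Submodule.span k (Set.range y) ⊔ auxV B * auxV B, b = C c + v := by
    intro b hb
    induction hb using Algebra.adjoin_induction with
    | mem x hx => exact ⟨0, x, Submodule.mem_sup_left (Submodule.subset_span hx), by simp⟩
    | algebraMap r => exact ⟨r, 0, zero_mem _, by simp [algebraMap_eq]⟩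
    | add x x' _ _ h h' =>
      obtain ⟨c, v, hv, rfl⟩ := h
      obtain ⟨c', v', hv', rfl⟩ := h'
      exact ⟨c + c', v + v', add_mem hv hv', by rw [C_add]; ring⟩
    | mul x x' _ _ h h' =>
      obtain ⟨c, v, hv, rfl⟩ := h
      obtain ⟨c', v', hv', rfl⟩ := h'
      refine ⟨c * c', c • v' + c' • v + v * v', add_mem (add_mem (Submodule.smul_mem _ _ hv')
        (Submodule.smul_mem _ _ hv)) (Submodule.mem_sup_right (Submodule.mul_mem_mul
          ((sup_le hle hVV) hv) ((sup_le hle hVV) hv'))), ?_⟩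
      rw [C_mul, smul_eq_C_mul, smul_eq_C_mul]; ring
  intro b hb
  obtain ⟨c, v, hv, rfl⟩ := key b (hBy ((auxV_mem _ _).1 hb).1)
  have h0 := ((auxV_mem _ _).1 hb).2
  have hv0 := ((auxV_mem _ _).1 ((sup_le hle hVV) hv)).2
  rw [map_add, hv0, add_zero, aux_hc_of_hom (isHomogeneous_C _ c), if_pos rfl] at h0
  rw [h0, zero_add]
  exact hv

/-- pick at most `m` homogeneous elements -/
theorem aux_pick (B : Subalgebra k (MvPolynomial (Fin n) k))
    (hB : ∀ b ∈ B, ∀ d, homogeneousComponent d b ∈ B)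
    (y : Fin m → MvPolynomial (Fin n) k)
    (hV : auxV B ≤ Submodule.span k (Set.range y) ⊔ auxV B * auxV B) :
    ∃ (f : Fin m → MvPolynomial (Fin n) k) (deg : Fin m → ℕ),
      (∀ i, (f i).IsHomogeneous (deg i)) ∧ (∀ i, f i ∈ auxV B) ∧
      auxV B ≤ Submodule.span k (Set.range f) ⊔ auxV B * auxV B := by
  classical
  let π := (auxV B * auxV B).mkQ
  let H : Set (MvPolynomial (Fin n) k) := {x | x ∈ auxV B ∧ ∃ d, x.IsHomogeneous d}
  have hVH : auxV B ≤ Submodule.span k H := by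
    intro x hx
    refine aux_mem_of_hc _ x fun d => Submodule.subset_span ⟨auxV_hc B hB x hx d, d,
      homogeneousComponent_isHomogeneous d x⟩
  have hπV : Submodule.map π (auxV B) ≤ Submodule.span k (Set.range (π ∘ y)) := by
    rw [Set.range_comp, ← Submodule.map_span]
    refine (Submodule.map_mono hV).trans ?_
    rw [Submodule.map_sup, Submodule.mkQ_map_self, sup_bot_eq]
  obtain ⟨b, hbH, hspan, hli⟩ := exists_linearIndependent k (π '' H)
  have hbsub : b ⊆ Submodule.span k (Set.range (π ∘ y)) := by
    intro x hx
    obtain ⟨z, hz, rfl⟩ := hbH hx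
    exact hπV (Submodule.mem_map_of_mem hz.1)
  have hcard : Cardinal.mk b ≤ m := by
    have h1 : LinearIndependent k (fun x : b => (⟨x.1, hbsub x.2⟩ :
        Submodule.span k (Set.range (π ∘ y)))) :=
      LinearIndependent.of_comp (Submodule.subtype _) (by exact hli)
    have h2 := h1.cardinal_le_rank
    refine h2.trans ((rank_span_le _).trans ?_)
    have h3 := Cardinal.mk_range_le_lift (f := π ∘ y)
    simpa using h3
  have hfin : Finite b := by
    rw [← Cardinal.lt_aleph0_iff_finite]
    exact hcard.trans_lt (Cardinal.natCast_lt_aleph0)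
  have := Fintype.ofFinite b
  have hcard' : Fintype.card b ≤ Fintype.card (Fin m) := by
    simpa using hcard
  obtain ⟨g⟩ := Function.Embedding.nonempty_of_card_le hcard'
  choose z hz hzπ using fun x : b => hbH x.2
  let f : Fin m → MvPolynomial (Fin n) k := fun i =>
    if h : ∃ x, g x = i then z h.choose else 0
  have hfg : ∀ x, f (g x) = z x := by
    intro x
    have h : ∃ x', g x' = g x := ⟨x, rfl⟩
    simp only [f, dif_pos h]
    rw [g.injective h.choose_spec]
  have hfH : ∀ i, f i ∈ H := by
    intro i
    simp only [f]
    split_ifs with h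
    · exact hz _
    · exact ⟨zero_mem _, 0, isHomogeneous_zero _ _ _⟩
  choose deg hdeg using fun i => (hfH i).2
  refine ⟨f, deg, hdeg, fun i => (hfH i).1, ?_⟩
  have h3 : Submodule.map π (auxV B) ≤ Submodule.map π (Submodule.span k (Set.range f)) := by
    refine (Submodule.map_mono hVH).trans ?_
    rw [Submodule.map_span, ← hspan, Submodule.span_le]
    intro x hx
    refine ⟨z ⟨x, hx⟩, ?_, hzπ ⟨x, hx⟩⟩
    exact Submodule.subset_span ⟨g ⟨x, hx⟩, hfg _⟩
  intro x hx
  obtain ⟨s, hs, hsx⟩ := h3 (Submodule.mem_map_of_mem hx)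
  have h4 : x - s ∈ auxV B * auxV B := by
    rw [← Submodule.ker_mkQ (auxV B * auxV B), LinearMap.mem_ker, map_sub, sub_eq_zero]
    exact hsx.symm
  exact Submodule.mem_sup.2 ⟨s, hs, x - s, h4, by ring⟩

theorem aux_homogeneous_generators (B : Subalgebra k (MvPolynomial (Fin n) k))
    (hB : ∀ b ∈ B, ∀ d, homogeneousComponent d b ∈ B)
    (e : B ≃ₐ[k] MvPolynomial (Fin m) k) :
    ∃ (f : Fin m → MvPolynomial (Fin n) k) (deg : Fin m → ℕ),
      (∀ i, (f i).IsHomogeneous (deg i)) ∧ AlgebraicIndependent k f ∧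
      Algebra.adjoin k (Set.range f) = B := by
  let y0 : Fin m → MvPolynomial (Fin n) k := fun i => (e.symm (X i) : B)
  let y : Fin m → MvPolynomial (Fin n) k := fun i => y0 i - C (coeff 0 (y0 i))
  have hy : ∀ i, y i ∈ auxV B := by
    intro i
    rw [auxV_mem]
    refine ⟨sub_mem (e.symm (X i)).2 (Subalgebra.algebraMap_mem B _), ?_⟩
    simp [y, homogeneousComponent_zero]
  have hBy : B ≤ Algebra.adjoin k (Set.range y) := by
    intro b hb
    have h1 : ∀ P : MvPolynomial (Fin m) k,
        ((e.symm P : B) : MvPolynomial (Fin n) k) ∈ Algebra.adjoin k (Set.range y) := by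
      intro P
      induction P using MvPolynomial.induction_on with
      | C a =>
        rw [← algebraMap_eq, AlgEquiv.commutes]
        exact Subalgebra.algebraMap_mem _ a
      | add P Q hP hQ => rw [map_add]; exact add_mem hP hQ
      | mul_X P i hP =>
        rw [map_mul]
        refine mul_mem hP ?_
        have : ((e.symm (X i) : B) : MvPolynomial (Fin n) k) = y i + C (coeff 0 (y0 i)) := by
          simp [y, y0]
        rw [this]
        exact add_mem (Algebra.subset_adjoin ⟨i, rfl⟩) (Subalgebra.algebraMap_mem _ _)
    simpa using h1 (e ⟨b, hb⟩)
  obtain ⟨f, deg, hf, hfV, hspan⟩ := aux_pick B hB y (aux_V_le B y hy hBy)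
  have h1 := aux_graded_nakayama B hB f deg hf hspan
  have hfB : ∀ i, f i ∈ B := fun i => ((auxV_mem _ _).1 (hfV i)).1
  have h2 : Algebra.adjoin k (Set.range f) = B := by
    refine le_antisymm (Algebra.adjoin_le ?_) h1
    rintro _ ⟨i, rfl⟩; exact hfB i
  refine ⟨f, deg, hf, ?_, h2⟩
  let ψ : MvPolynomial (Fin m) k →ₐ[k] B := aeval fun i => (⟨f i, hfB i⟩ : B)
  have hψ : ∀ P, (ψ P : MvPolynomial (Fin n) k) = aeval f P := by
    intro P
    have : B.val.comp ψ = aeval f := by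
      ext i; simp [ψ]
    exact DFunLike.congr_fun this P
  have hsurj : Function.Surjective ψ := by
    rintro ⟨b, hb⟩
    have := h1 hb
    rw [Algebra.adjoin_range_eq_range_aeval] at this
    obtain ⟨P, hP⟩ := this
    refine ⟨P, Subtype.ext ?_⟩
    rw [hψ]; exact hP
  have hinj := aux_ringHom_inj ((e : B →ₐ[k] MvPolynomial (Fin m) k).comp ψ).toRingHom
    (e.surjective.comp hsurj)
  rw [algebraicIndependent_iff]
  intro P hP
  apply (injective_iff_map_eq_zero _).1 hinj
  have : ψ P = 0 := Subtype.ext (by rw [hψ, hP]; rfl)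
  simp [this]

end field

section subst

variable {n : ℕ} {R : Type*} [CommRing R]

theorem aux_mem_inv (S : Set (Matrix (Fin n) (Fin n) R)) (x : MvPolynomial (Fin n) R) :
    x ∈ matrixInvariants S ↔ ∀ g ∈ S, linearSubstAlgHom g x = x := by
  simp only [matrixInvariants, Algebra.mem_iInf, AlgHom.mem_equalizer, AlgHom.coe_id, id]

theorem aux_subst_hc (g : Matrix (Fin n) (Fin n) R) (P : MvPolynomial (Fin n) R) (d : ℕ) :
    linearSubstAlgHom g (homogeneousComponent d P) =
      homogeneousComponent d (linearSubstAlgHom g P) := by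
  have hom : ∀ i, (linearSubstAlgHom g (homogeneousComponent i P)).IsHomogeneous i := by
    intro i
    have := (homogeneousComponent_isHomogeneous i P).aeval
      (fun i => ∑ j, C (g j i) * X j : Fin n → MvPolynomial (Fin n) R) (n := 1)
      (fun i => IsHomogeneous.sum _ _ _ fun j _ => isHomogeneous_C_mul_X _ _)
    rwa [one_mul] at this
  have h1 : linearSubstAlgHom g P = ∑ i ∈ Finset.range (P.totalDegree + 1),
      linearSubstAlgHom g (homogeneousComponent i P) := by
    rw [← map_sum, sum_homogeneousComponent]
  rw [h1, map_sum]
  simp only [aux_hc_of_hom (hom _)]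
  rw [Finset.sum_ite_eq]
  split_ifs with h
  · rfl
  · rw [homogeneousComponent_eq_zero, map_zero]
    simpa using h

theorem aux_inv_closed (S : Set (Matrix (Fin n) (Fin n) R)) (b : MvPolynomial (Fin n) R)
    (hb : b ∈ matrixInvariants S) (d : ℕ) : homogeneousComponent d b ∈ matrixInvariants S := by
  rw [aux_mem_inv] at *
  intro g hg
  rw [aux_subst_hc, hb g hg]

theorem aux_subst_mul (g h : Matrix (Fin n) (Fin n) R) (P : MvPolynomial (Fin n) R) :
    linearSubstAlgHom g (linearSubstAlgHom h P) = linearSubstAlgHom (g * h) P := by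
  have : (linearSubstAlgHom g).comp (linearSubstAlgHom h) = linearSubstAlgHom (g * h) := by
    ext1 i
    simp only [linearSubstAlgHom, AlgHom.comp_apply, aeval_X, map_sum, map_mul, Matrix.mul_apply,
      Finset.sum_mul, Finset.mul_sum, algHom_C, algebraMap_eq]
    rw [Finset.sum_comm]
    refine Finset.sum_congr rfl fun j _ => Finset.sum_congr rfl fun l _ => ?_
    ring
  exact DFunLike.congr_fun this P

theorem aux_subst_map {S : Type*} [CommRing S] (ρ : R →+* S) (g : Matrix (Fin n) (Fin n) R)
    (P : MvPolynomial (Fin n) R) :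
    map ρ (linearSubstAlgHom g P) = linearSubstAlgHom (g.map ρ) (map ρ P) := by
  induction P using MvPolynomial.induction_on with
  | C a => simp [linearSubstAlgHom]
  | add P Q hP hQ => simp only [map_add, hP, hQ]
  | mul_X P i hP =>
    rw [map_mul, map_mul, map_mul, map_mul, hP]
    congr 1
    simp [linearSubstAlgHom]

theorem aux_map_hc {S : Type*} [CommRing S] (ρ : R →+* S) (P : MvPolynomial (Fin n) R) (d : ℕ) :
    map ρ (homogeneousComponent d P) = homogeneousComponent d (map ρ P) := by
  ext e
  simp only [coeff_map, coeff_homogeneousComponent]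
  split_ifs <;> simp

/-- averaging -/
theorem aux_lift {S : Type*} [CommRing S] (ρ : R →+* S) (hρ : Function.Surjective ρ)
    (W : Subgroup (GL (Fin n) R)) [Finite W] (hu : IsUnit (Nat.card W : R))
    (b : MvPolynomial (Fin n) S)
    (hb : b ∈ matrixInvariants ((fun g : GL (Fin n) R =>
        (g : Matrix (Fin n) (Fin n) R).map ρ) '' (W : Set (GL (Fin n) R)))) :
    ∃ a ∈ matrixInvariants ((fun g : GL (Fin n) R =>
        (g : Matrix (Fin n) (Fin n) R)) '' (W : Set (GL (Fin n) R))), map ρ a = b := by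
  have := Fintype.ofFinite W
  obtain ⟨P, rfl⟩ := map_surjective ρ hρ b
  obtain ⟨v, hv⟩ := hu.exists_left_inv
  rw [aux_mem_inv] at hb
  refine ⟨C v * ∑ g : W, linearSubstAlgHom ((g : GL (Fin n) R) : Matrix (Fin n) (Fin n) R) P,
    ?_, ?_⟩
  · rw [aux_mem_inv]
    rintro _ ⟨h, hh, rfl⟩
    simp only [map_mul, map_sum, aux_subst_mul, algHom_C, algebraMap_eq]
    have hs := Equiv.sum_comp (Equiv.mulLeft (⟨h, hh⟩ : W)) (fun g : W =>
      linearSubstAlgHom ((g : GL (Fin n) R) : Matrix (Fin n) (Fin n) R) P)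
    rw [← hs]
    simp only [Equiv.coe_mulLeft, Subgroup.coe_mul, Units.val_mul]
  · rw [map_mul, map_sum]
    have : ∀ g : W, map ρ (linearSubstAlgHom
        ((g : GL (Fin n) R) : Matrix (Fin n) (Fin n) R) P) = map ρ P := by
      intro g
      rw [aux_subst_map]
      exact hb _ ⟨g, g.2, rfl⟩
    simp only [this]
    rw [Finset.sum_const, Finset.card_univ, ← Nat.card_eq_fintype_card, map_C, nsmul_eq_mul,
      ← mul_assoc, ← map_natCast (C : S →+* MvPolynomial (Fin n) S), ← C_mul,
      ← map_natCast ρ, ← map_mul, hv]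
    simp

end subst

section padic

variable {p n m : ℕ} [hp : Fact p.Prime]

theorem aux_ker (r : ℤ_[p]) : PadicInt.toZMod r = 0 ↔ (p : ℤ_[p]) ∣ r := by
  rw [← RingHom.mem_ker, PadicInt.ker_toZMod, PadicInt.maximalIdeal_eq_span_p,
    Ideal.mem_span_singleton]

theorem aux_map_zero {σ : Type*} (P : MvPolynomial σ ℤ_[p]) (h : map PadicInt.toZMod P = 0) :
    ∃ Q, P = (p : ℤ_[p]) • Q := by
  obtain ⟨Q, hQ⟩ := (C_dvd_iff_map_hom_eq_zero PadicInt.toZMod (p : ℤ_[p]) aux_ker P).2 h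
  exact ⟨Q, by rw [hQ, smul_eq_C_mul]⟩

theorem aux_p_ne : (p : ℤ_[p]) ≠ 0 := by
  exact_mod_cast hp.out.ne_zero

theorem aux_map_aeval (F : Fin m → MvPolynomial (Fin n) ℤ_[p]) (P : MvPolynomial (Fin m) ℤ_[p]) :
    map PadicInt.toZMod (aeval F P) =
      aeval (fun i => map PadicInt.toZMod (F i)) (map PadicInt.toZMod P) := by
  induction P using MvPolynomial.induction_on with
  | C a => simp [algebraMap_eq]
  | add P Q hP hQ => simp only [map_add, hP, hQ]
  | mul_X P i hP => rw [map_mul, map_mul, map_mul, map_mul, hP]; simp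

theorem aux_indep (F : Fin m → MvPolynomial (Fin n) ℤ_[p])
    (h : AlgebraicIndependent (ZMod p) (fun i => map PadicInt.toZMod (F i))) :
    AlgebraicIndependent ℤ_[p] F := by
  rw [algebraicIndependent_iff] at h ⊢
  have key : ∀ k : ℕ, ∀ P : MvPolynomial (Fin m) ℤ_[p], aeval F P = 0 → ∃ Q, P = (p : ℤ_[p]) ^ k • Q := by
    intro k
    induction k with
    | zero => exact fun P _ => ⟨P, by simp⟩
    | succ k ih =>
      intro P hP
      have h1 := h (map PadicInt.toZMod P) (by rw [← aux_map_aeval, hP, map_zero])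
      obtain ⟨Q, rfl⟩ := aux_map_zero P h1
      rw [map_smul] at hP
      obtain ⟨Q', rfl⟩ := ih Q ((smul_eq_zero.1 hP).resolve_left aux_p_ne)
      exact ⟨Q', by rw [smul_smul, pow_succ']⟩
  intro P hP
  ext d
  rw [coeff_zero]
  by_contra hne
  obtain ⟨k, hk⟩ := FiniteMultiplicity.of_not_isUnit PadicInt.prime_p.not_isUnit hne
  obtain ⟨Q, hQ⟩ := key (k + 1) P hP
  apply hk
  rw [hQ, coeff_smul, smul_eq_mul]
  exact dvd_mul_right _ _

theorem aux_surj (A : Subalgebra ℤ_[p] (MvPolynomial (Fin n) ℤ_[p]))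
    (hA : ∀ b ∈ A, ∀ d, homogeneousComponent d b ∈ A)
    (hAp : ∀ b, (p : ℤ_[p]) • b ∈ A → b ∈ A)
    (F : Fin m → MvPolynomial (Fin n) ℤ_[p]) (deg : Fin m → ℕ)
    (hF : ∀ i, (F i).IsHomogeneous (deg i)) (hFA : ∀ i, F i ∈ A)
    (h : ∀ a ∈ A, map PadicInt.toZMod a ∈ Algebra.adjoin (ZMod p)
      (Set.range fun i => map PadicInt.toZMod (F i))) :
    Algebra.adjoin ℤ_[p] (Set.range F) = A := by
  have hle : Algebra.adjoin ℤ_[p] (Set.range F) ≤ A :=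
    Algebra.adjoin_le (by rintro _ ⟨i, rfl⟩; exact hFA i)
  refine le_antisymm hle ?_
  have key : ∀ a ∈ A, ∃ a' ∈ Algebra.adjoin ℤ_[p] (Set.range F), ∃ c ∈ A,
      a = a' + (p : ℤ_[p]) • c := by
    intro a ha
    have h1 := h a ha
    rw [Algebra.adjoin_range_eq_range_aeval] at h1
    obtain ⟨P, hP⟩ := h1
    obtain ⟨P, rfl⟩ := map_surjective PadicInt.toZMod (ZMod.ringHom_surjective _) P
    have hP' : aeval F P ∈ Algebra.adjoin ℤ_[p] (Set.range F) := by
      rw [Algebra.adjoin_range_eq_range_aeval]; exact ⟨P, rfl⟩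
    obtain ⟨c, hc⟩ := aux_map_zero (a - aeval F P) (by
      rw [map_sub, aux_map_aeval, sub_eq_zero]; exact hP.symm)
    refine ⟨aeval F P, hP', c, hAp c ?_, ?_⟩
    · rw [← hc]; exact sub_mem ha (hle hP')
    · rw [← hc]; ring
  have main : ∀ d, Subalgebra.toSubmodule A ⊓ homogeneousSubmodule (Fin n) ℤ_[p] d ≤
      Subalgebra.toSubmodule (Algebra.adjoin ℤ_[p] (Set.range F)) := by
    intro d
    refine Submodule.le_of_le_smul_of_le_jacobson_bot
      (I := IsLocalRing.maximalIdeal ℤ_[p]) ?_ (IsLocalRing.maximalIdeal_le_jacobson _) ?_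
    · have hfg := homogeneousSubmodule_fg (σ := Fin n) (R := ℤ_[p]) d
      have := isNoetherian_of_fg_of_noetherian _ hfg
      exact Submodule.FG.of_le hfg inf_le_right
    · rintro a ⟨haA, had⟩
      obtain ⟨a', ha', c, hc, hac⟩ := key a haA
      have h2 : a = homogeneousComponent d a' + (p : ℤ_[p]) • homogeneousComponent d c := by
        rw [← map_smul, ← map_add, ← hac]
        exact (homogeneousComponent_eq_self had).symm
      rw [h2]
      refine Submodule.add_mem_sup (aux_adjoin_closed F deg hF a' ha' d) ?_
      refine Submodule.smul_mem_smul ?_ ⟨hA c hc d, homogeneousComponent_mem d c⟩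
      rw [PadicInt.maximalIdeal_eq_span_p]
      exact Ideal.mem_span_singleton_self _
  intro a ha
  exact aux_mem_of_hc (Subalgebra.toSubmodule (Algebra.adjoin ℤ_[p] (Set.range F))) a
    (fun d => main d ⟨hA a ha d, homogeneousComponent_mem d a⟩)

theorem aux_unit (N : ℕ) (h : ¬ p ∣ N) : IsUnit (N : ℤ_[p]) := by
  by_contra hN
  have h1 : (N : ℤ_[p]) ∈ IsLocalRing.maximalIdeal ℤ_[p] := hN
  rw [← PadicInt.ker_toZMod, RingHom.mem_ker, map_natCast] at h1
  exact h ((ZMod.natCast_eq_zero_iff _ _).1 h1)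

end padic

/-- Let `p` be a prime, `L` a finitely generated free `ℤ_p`-module (identified
with `ℤ_p^n` via a basis), and `W` a finite subgroup of `GL_n(ℤ_p)` whose order is not divisible
by `p`.  If the invariant ring `F_p[L ⊗ F_p]^W` is a polynomial algebra over `F_p`, then the
invariant ring `ℤ_p[L]^W` is a polynomial algebra over `ℤ_p`. -/
theorem integral_invariants_polynomial_of_mod_p_invariants_polynomial
    (p n : ℕ) [Fact p.Prime]
    (W : Subgroup (GL (Fin n) ℤ_[p])) (hWfin : Finite W)
    (hord : ¬ p ∣ Nat.card W)
    (hF : IsPolynomialAlgebra (ZMod p)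
      (matrixInvariants ((fun g : GL (Fin n) ℤ_[p] =>
        (g : Matrix (Fin n) (Fin n) ℤ_[p]).map (PadicInt.toZMod : ℤ_[p] → ZMod p)) ''
          (W : Set (GL (Fin n) ℤ_[p]))))) :
    IsPolynomialAlgebra ℤ_[p]
      (matrixInvariants ((fun g : GL (Fin n) ℤ_[p] =>
        (g : Matrix (Fin n) (Fin n) ℤ_[p])) '' (W : Set (GL (Fin n) ℤ_[p])))) := by
  obtain ⟨m, ⟨e⟩⟩ := hF
  obtain ⟨f, deg, hf, hind, hadj⟩ := aux_homogeneous_generators _ (aux_inv_closed _) e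
  have hfB := fun i => hadj.le (Algebra.subset_adjoin (Set.mem_range_self i))
  choose G hGA hG using fun i => aux_lift (PadicInt.toZMod : ℤ_[p] →+* ZMod p)
    (ZMod.ringHom_surjective _) W (aux_unit _ hord) (f i) (hfB i)
  let F := fun i => homogeneousComponent (deg i) (G i)
  have hFf : (fun i => map PadicInt.toZMod (F i)) = f := by
    funext i
    simp only [F]
    rw [aux_map_hc, hG i]
    exact homogeneousComponent_eq_self (hf i)
  have hFind : AlgebraicIndependent ℤ_[p] F := aux_indep F (by rw [hFf]; exact hind)
  refine ⟨m, ⟨AlgEquiv.symm (hFind.aevalEquiv.trans (Subalgebra.equivOfEq _ _ ?_))⟩⟩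
  refine aux_surj _ (aux_inv_closed _) ?_ F deg
    (fun i => homogeneousComponent_isHomogeneous _ _) (fun i => aux_inv_closed _ _ (hGA i) _) ?_
  · intro b hb
    rw [aux_mem_inv] at hb ⊢
    intro g hg
    have := hb g hg
    rw [map_smul] at this
    exact smul_right_injective _ aux_p_ne this
  · intro a ha
    rw [hFf, hadj, aux_mem_inv]
    rintro _ ⟨g, hg, rfl⟩
    rw [aux_mem_inv] at ha
    have := ha _ ⟨g, hg, rfl⟩
    exact (aux_subst_map _ _ _).symm.trans (congrArg _ this)
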